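/- arXiv:2308.14124 — 5 statements merged into one kernel-verified Lean document; each statement's English description precedes it below -/
import Mathlib

section
/- Let k ≥ 1 and let I be an instance of k-TC with n − 1 ≥ 1 non-depot vertices. Let I′ be the extended instance obtained by adding p new non-depot vertices co-located with the depot (weight w(o,a) to any original vertex a, weight 0 among themselves). If p ≥ (k−1)·(n−1) and k divides (n−1) + p, then I′ admits an optimal feasible solution that is saturated, i.e., in which every tour contains exactly k non-depot vertices; moreover this optimal value equals OPT(I). -/
/-- The weight of a walk given by a list of vertices: the sum of `w` over
consecutive pairs. -/
def pathWeight {V : Type*} (w : V → V → ℝ) : List V → ℝ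
  | a :: b :: rest => w a b + pathWeight w (b :: rest)
  | _ => 0

/-- The weight of the tour `o, v₁, …, v_l, o` represented by the list `T = [v₁, …, v_l]`. -/
def tourWeight {V : Type*} (w : V → V → ℝ) (o : V) (T : List V) : ℝ :=
  pathWeight w (o :: T ++ [o])

/-- A tour for `k`-TC: a nonempty list of distinct non-depot vertices of length at most `k`. -/
def IsTour {V : Type*} (k : ℕ) (o : V) (T : List V) : Prop :=
  T ≠ [] ∧ T.Nodup ∧ T.length ≤ k ∧ ∀ v ∈ T, v ≠ o

/-- A feasible solution of `k`-TC: a finite collection of tours whose vertex lists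
partition `V \ {o}`. -/
def IsFeasible {V : Type*} (k : ℕ) (o : V) (S : List (List V)) : Prop :=
  (∀ T ∈ S, IsTour k o T) ∧ S.flatten.Nodup ∧ ∀ v : V, v ∈ S.flatten ↔ v ≠ o

/-- `OPT` for `k`-TC: the infimum of the weights of feasible solutions. -/
noncomputable def optTC {V : Type*} (k : ℕ) (o : V) (w : V → V → ℝ) : ℝ :=
  sInf {x : ℝ | ∃ S : List (List V), IsFeasible k o S ∧ (S.map (tourWeight w o)).sum = x}

/-- The weight function of the extended instance `I′` obtained by adding `p` new
non-depot vertices co-located with the depot: the weight between a new vertex and an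
original vertex `a` is `w(o, a)`, and the weight between two new vertices is `0`. -/
def extWeight {V : Type*} (w : V → V → ℝ) (o : V) (p : ℕ) :
    V ⊕ Fin p → V ⊕ Fin p → ℝ
  | Sum.inl a, Sum.inl b => w a b
  | Sum.inl a, Sum.inr _ => w o a
  | Sum.inr _, Sum.inl b => w o b
  | Sum.inr _, Sum.inr _ => 0


theorem pathWeight_map {α β : Type*} (w : β → β → ℝ) (f : α → β) (l : List α) :
    pathWeight w (l.map f) = pathWeight (fun a b => w (f a) (f b)) l := by
  induction l with
  | nil => rfl
  | cons a l ih =>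
    cases l with
    | nil => rfl
    | cons b l => simpa [pathWeight] using ih

theorem pathWeight_append_repeat {α : Type*} (w : α → α → ℝ) (a : α) (ha : w a a = 0)
    (l : List α) : pathWeight w (l ++ [a, a]) = pathWeight w (l ++ [a]) := by
  induction l with
  | nil => simp [pathWeight, ha]
  | cons b l ih => cases l <;> simp_all [pathWeight]

theorem tourWeight_append_replicate {α : Type*} (w : α → α → ℝ) (o : α) (ho : w o o = 0)
    (T : List α) (m : ℕ) : tourWeight w o (T ++ List.replicate m o) = tourWeight w o T := by
  induction m with
  | zero => simp
  | succ m ih =>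
    rw [← ih]
    have h := pathWeight_append_repeat w o ho (o :: (T ++ List.replicate m o))
    simpa [tourWeight, List.replicate_succ'] using h

/-- Deleting the first vertex after the start does not increase the weight of a walk. -/
theorem pathWeight_cons_le {α : Type*} (w : α → α → ℝ) (hnonneg : ∀ a b, 0 ≤ w a b)
    (htri : ∀ a b c, w a c ≤ w a b + w b c) (a x : α) (l : List α) :
    pathWeight w (a :: l) ≤ pathWeight w (a :: x :: l) := by
  cases l with
  | nil => simpa [pathWeight] using hnonneg a x
  | cons y l =>
    simp only [pathWeight]
    linarith [htri a x y]

theorem List.Sublist.pathWeight_cons_append_le {α : Type*} (w : α → α → ℝ)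
    (hnonneg : ∀ a b, 0 ≤ w a b) (htri : ∀ a b c, w a c ≤ w a b + w b c)
    {l₁ l₂ : List α} (h : l₁.Sublist l₂) (r : List α) (a : α) :
    pathWeight w (a :: (l₁ ++ r)) ≤ pathWeight w (a :: (l₂ ++ r)) := by
  induction h generalizing a with
  | slnil => exact le_rfl
  | cons x _ ih =>
    exact (ih a).trans (pathWeight_cons_le w hnonneg htri a x _)
  | cons_cons x _ ih =>
    simpa [pathWeight] using ih x

theorem List.Sublist.tourWeight_le {α : Type*} (w : α → α → ℝ)
    (hnonneg : ∀ a b, 0 ≤ w a b) (htri : ∀ a b c, w a c ≤ w a b + w b c)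
    {l₁ l₂ : List α} (h : l₁.Sublist l₂) (o : α) :
    tourWeight w o l₁ ≤ tourWeight w o l₂ :=
  h.pathWeight_cons_append_le w hnonneg htri [o] o

theorem extWeight_eq {V : Type*} (w : V → V → ℝ) (o : V) (p : ℕ) (hdiag : ∀ a, w a a = 0)
    (hsymm : ∀ a b, w a b = w b a) :
    extWeight w o p = fun x y => w (Sum.elim id (fun _ => o) x) (Sum.elim id (fun _ => o) y) := by
  funext x y
  rcases x with a | i <;> rcases y with b | j <;> simp [extWeight, hdiag, hsymm o]

theorem tourWeight_extWeight {V : Type*} (w : V → V → ℝ) (o : V) (p : ℕ)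
    (hdiag : ∀ a, w a a = 0) (hsymm : ∀ a b, w a b = w b a) (T : List (V ⊕ Fin p)) :
    tourWeight (extWeight w o p) (Sum.inl o) T
      = tourWeight w o (T.map (Sum.elim id (fun _ => o))) := by
  rw [tourWeight, extWeight_eq w o p hdiag hsymm, ← pathWeight_map]
  simp [tourWeight]

theorem filterMap_getLeft_sublist {α β : Type*} (o : α) (l : List (α ⊕ β)) :
    (l.filterMap Sum.getLeft?).Sublist (l.map (Sum.elim id (fun _ => o))) := by
  induction l with
  | nil => simp
  | cons x l ih =>
    rcases x with a | b
    · simpa using ih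
    · simpa [List.filterMap_cons] using ih.cons o

/-- Restricting a feasible solution of the extended instance to the original vertices. -/
theorem IsFeasible.exists_restrict {V : Type*} {k p : ℕ} {o : V} {w : V → V → ℝ}
    (hnonneg : ∀ a b, 0 ≤ w a b) (hdiag : ∀ a, w a a = 0)
    (hsymm : ∀ a b, w a b = w b a) (htri : ∀ a b c, w a c ≤ w a b + w b c)
    {S : List (List (V ⊕ Fin p))} (hS : IsFeasible k (Sum.inl o) S) :
    ∃ S' : List (List V), IsFeasible k o S' ∧
      (S'.map (tourWeight w o)).sum
        ≤ (S.map (tourWeight (extWeight w o p) (Sum.inl o))).sum := by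
  classical
  obtain ⟨hT, hnd, hmem⟩ := hS
  have hinj : ∀ (a a' : V ⊕ Fin p) (b : V),
      b ∈ a.getLeft? → b ∈ a'.getLeft? → a = a' := by
    rintro (a | i) (a' | i') b <;> simp
    rintro rfl rfl; rfl
  have hmemL : ∀ (l : List (V ⊕ Fin p)) (v : V),
      v ∈ l.filterMap Sum.getLeft? ↔ Sum.inl v ∈ l := by
    intro l v; simp [Sum.getLeft?_eq_some_iff]
  have hfl : ((S.map (List.filterMap Sum.getLeft?)).filter (· ≠ [])).flatten
      = S.flatten.filterMap Sum.getLeft? := by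
    rw [List.flatten_filter_ne_nil, List.filterMap_flatten]
  refine ⟨(S.map (List.filterMap Sum.getLeft?)).filter (· ≠ []), ⟨?_, ?_, ?_⟩, ?_⟩
  · intro T hTm
    simp only [ne_eq, decide_not, List.mem_filter, List.mem_map, Bool.not_eq_eq_eq_not,
      Bool.not_true, decide_eq_false_iff_not] at hTm
    obtain ⟨⟨T, hTS, rfl⟩, hne⟩ := hTm
    obtain ⟨-, h2, h3, h4⟩ := hT T hTS
    refine ⟨hne, h2.filterMap hinj, (List.length_filterMap_le _ _).trans h3, ?_⟩
    intro v hv hvo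
    exact h4 _ ((hmemL T v).1 hv) (by rw [hvo])
  · rw [hfl]
    exact hnd.filterMap hinj
  · intro v
    rw [hfl, hmemL, hmem]
    simp
  · have hle : ∀ L : List (List V), ((L.filter (· ≠ [])).map (tourWeight w o)).sum
        = (L.map (tourWeight w o)).sum := by
      intro L
      induction L with
      | nil => rfl
      | cons T L ih =>
        by_cases h : T = []
        · simp_all [tourWeight, pathWeight]
        · simp_all
    rw [hle, List.map_map]
    refine List.sum_le_sum fun T _ => ?_
    rw [tourWeight_extWeight w o p hdiag hsymm]
    exact (filterMap_getLeft_sublist o T).tourWeight_le w hnonneg htri o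

theorem List.length_flatten_le {α : Type*} {k : ℕ} {S : List (List α)}
    (hS : ∀ T ∈ S, T.length ≤ k) : S.flatten.length ≤ k * S.length := by
  rw [List.length_flatten, mul_comm, ← smul_eq_mul, ← List.length_map (f := List.length)]
  exact List.sum_le_card_nsmul _ _ (by simpa using hS)

theorem List.length_le_length_flatten {α : Type*} {S : List (List α)}
    (hS : ∀ T ∈ S, T ≠ []) : S.length ≤ S.flatten.length := by
  induction S with
  | nil => simp
  | cons T S ih =>
    have h1 := List.length_pos_iff.2 (hS T (by simp))
    have h2 := ih fun T hT => hS T (by simp [hT])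
    simp only [List.length_cons, List.flatten_cons, List.length_append]
    omega

theorem exists_chunks {α : Type*} (k : ℕ) (m : ℕ) (D : List α) (hD : D.length = k * m) :
    ∃ S : List (List α), (∀ T ∈ S, T.length = k) ∧ S.flatten = D := by
  induction m generalizing D with
  | zero => exact ⟨[], by simp, by simp_all⟩
  | succ m ih =>
    rw [mul_add, mul_one] at hD
    obtain ⟨S, h1, h2⟩ := ih (D.drop k) (by simp [hD])
    refine ⟨D.take k :: S, ?_, by simp [h2]⟩
    simpa [hD] using h1

/-- A collection of lists of length at most `k` can be padded with the entries of `D`, adding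
further lists made up of entries of `D`, so that every list has length exactly `k`. -/
theorem exists_padding {α : Type*} (k : ℕ) (f : List α → ℝ) (S : List (List α)) (D : List α)
    (hS : ∀ T ∈ S, T.length ≤ k) (hcard : k * S.length ≤ S.flatten.length + D.length)
    (hdvd : k ∣ S.flatten.length + D.length)
    (hnil : f [] = 0) (hf : ∀ T, ∀ d ⊆ D, f (T ++ d) = f T) :
    ∃ S' : List (List α), (∀ T ∈ S', T.length = k) ∧ S'.flatten.Perm (S.flatten ++ D) ∧
      (S'.map f).sum = (S.map f).sum := by
  induction S generalizing D with
  | nil =>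
    obtain ⟨m, hm⟩ := hdvd
    obtain ⟨S', h1, h2⟩ := exists_chunks k m D (by simpa using hm)
    refine ⟨S', h1, by simp [h2], ?_⟩
    simp only [List.map_nil, List.sum_nil]
    refine List.sum_eq_zero fun x hx => ?_
    obtain ⟨T, hT, rfl⟩ := List.mem_map.1 hx
    have := hf [] T fun a ha => h2 ▸ List.mem_flatten.2 ⟨T, hT, ha⟩
    simpa [hnil] using this
  | cons T S ih =>
    have hT : T.length ≤ k := hS T (by simp)
    have hS' : ∀ T ∈ S, T.length ≤ k := fun T hT => hS T (by simp [hT])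
    have hle := List.length_flatten_le hS'
    simp only [List.length_cons, List.flatten_cons, List.length_append, mul_add, mul_one]
      at hcard hdvd
    have hlen : (D.drop (k - T.length)).length = D.length - (k - T.length) := by simp
    obtain ⟨S', h1, h2, h3⟩ := ih (D.drop (k - T.length)) hS' (by omega)
      (by
        have : T.length + S.flatten.length + D.length
            = (S.flatten.length + (D.drop (k - T.length)).length) + k := by omega
        rw [this] at hdvd
        exact (Nat.dvd_add_left dvd_rfl).1 hdvd)
      (fun T d hd => hf T d (List.Subset.trans hd (List.drop_subset _ _)))
    refine ⟨(T ++ D.take (k - T.length)) :: S', ?_, ?_, ?_⟩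
    · intro U hU
      rcases List.mem_cons.1 hU with rfl | hU
      · simp only [List.length_append, List.length_take]
        omega
      · exact h1 U hU
    · simp only [List.flatten_cons, List.append_assoc]
      refine List.Perm.append_left T ?_
      refine (h2.append_left _).trans ?_
      refine (List.perm_append_comm_assoc _ _ _).trans ?_
      rw [List.take_append_drop]
    · simp [h3, hf T _ (List.take_subset _ _)]

theorem IsFeasible.length_flatten {V : Type*} [Fintype V] [DecidableEq V] {k : ℕ} {o : V}
    {S : List (List V)} (hS : IsFeasible k o S) :
    S.flatten.length = Fintype.card V - 1 := by
  rw [← List.toFinset_card_of_nodup hS.2.1, ← Finset.card_univ,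
    ← Finset.card_erase_of_mem (Finset.mem_univ o)]
  congr 1
  ext v
  simp [← hS.2.2 v]

theorem finite_isFeasible {V : Type*} [Finite V] (k : ℕ) (o : V) :
    {S : List (List V) | IsFeasible k o S}.Finite := by
  classical
  have := Fintype.ofFinite V
  have : Finite {T : List V // T.length ≤ k} := (List.finite_length_le V k).to_subtype
  refine ((List.finite_length_le {T : List V // T.length ≤ k} (Fintype.card V - 1)).image
    (List.map Subtype.val)).subset ?_
  intro S hS
  have hlen := (List.length_le_length_flatten fun T hT => (hS.1 T hT).1).trans_eq
    hS.length_flatten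
  lift S to List {T : List V // T.length ≤ k} using fun T hT => (hS.1 T hT).2.2.1
  exact ⟨S, by simpa using hlen, rfl⟩

theorem exists_isFeasible {V : Type*} [Finite V] {k : ℕ} (hk : 1 ≤ k) (o : V) :
    ∃ S : List (List V), IsFeasible k o S := by
  classical
  have := Fintype.ofFinite V
  have hfl : ((Finset.univ.erase o).toList.map fun v => [v]).flatten
      = (Finset.univ.erase o).toList := by
    rw [← List.flatMap_def]; simp
  refine ⟨(Finset.univ.erase o).toList.map fun v => [v], ?_, ?_, ?_⟩
  · intro T hT
    obtain ⟨v, hv, rfl⟩ := List.mem_map.1 hT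
    simpa [IsTour, hk] using hv
  · rw [hfl]; exact Finset.nodup_toList _
  · intro v; rw [hfl]; simp

theorem exists_isFeasible_isLeast {V : Type*} [Finite V] {k : ℕ} (hk : 1 ≤ k) (o : V)
    (w : V → V → ℝ) :
    ∃ S : List (List V), IsFeasible k o S ∧ ∀ S', IsFeasible k o S' →
      (S.map (tourWeight w o)).sum ≤ (S'.map (tourWeight w o)).sum :=
  (finite_isFeasible k o).exists_minimalFor (fun S => (S.map (tourWeight w o)).sum) _
    (exists_isFeasible hk o) |>.imp fun _ h => ⟨h.1, fun _ hS' => (le_total _ _).elim id (h.2 hS')⟩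

theorem optTC_eq_of_isLeast {V : Type*} {k : ℕ} {o : V} {w : V → V → ℝ} {S : List (List V)}
    (hS : IsFeasible k o S) (hmin : ∀ S', IsFeasible k o S' →
      (S.map (tourWeight w o)).sum ≤ (S'.map (tourWeight w o)).sum) :
    optTC k o w = (S.map (tourWeight w o)).sum := by
  refine IsLeast.csInf_eq ⟨⟨S, hS, rfl⟩, ?_⟩
  rintro _ ⟨S', hS', rfl⟩
  exact hmin S' hS'

/-- Padding the tours of a feasible solution with new vertices yields a saturated solution of
the extended instance with the same weight. -/
theorem IsFeasible.exists_saturated {V : Type*} [Fintype V] [DecidableEq V] {k p : ℕ} {o : V}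
    {w : V → V → ℝ} (hk : 1 ≤ k) (hdiag : ∀ a, w a a = 0) (hsymm : ∀ a b, w a b = w b a)
    (hp : (k - 1) * (Fintype.card V - 1) ≤ p) (hdiv : k ∣ (Fintype.card V - 1) + p)
    {S : List (List V)} (hS : IsFeasible k o S) :
    ∃ S' : List (List (V ⊕ Fin p)), IsFeasible k (Sum.inl o) S' ∧ (∀ T ∈ S', T.length = k) ∧
      (S'.map (tourWeight (extWeight w o p) (Sum.inl o))).sum
        = (S.map (tourWeight w o)).sum := by
  have hcount := (List.length_le_length_flatten fun T hT => (hS.1 T hT).1).trans_eq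
    hS.length_flatten
  have hfl : (S.map (List.map (Sum.inl : V → V ⊕ Fin p))).flatten = S.flatten.map Sum.inl :=
    List.map_flatten.symm
  have hlen : (S.map (List.map (Sum.inl : V → V ⊕ Fin p))).flatten.length
      + ((List.finRange p).map (Sum.inr : Fin p → V ⊕ Fin p)).length
      = (Fintype.card V - 1) + p := by
    rw [hfl, List.length_map, hS.length_flatten]; simp
  obtain ⟨S', h1, h2, h3⟩ := exists_padding k (tourWeight (extWeight w o p) (Sum.inl o))
    (S.map (List.map Sum.inl)) ((List.finRange p).map Sum.inr)
    (by
      intro T hT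
      obtain ⟨U, hU, rfl⟩ := List.mem_map.1 hT
      simpa using (hS.1 U hU).2.2.1)
    (by
      rw [hlen, List.length_map]
      calc k * S.length ≤ k * (Fintype.card V - 1) := Nat.mul_le_mul_left k hcount
        _ = (k - 1) * (Fintype.card V - 1) + (Fintype.card V - 1) := by
          rw [← Nat.succ_mul, Nat.succ_eq_add_one, Nat.sub_add_cancel hk]
        _ ≤ _ := by omega)
    (by rwa [hlen])
    (by simp [tourWeight, pathWeight, extWeight, hdiag])
    (by
      intro T d hd
      have hrep : d.map (Sum.elim id fun _ => o) = List.replicate d.length o := by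
        rw [List.eq_replicate_iff]
        refine ⟨by simp, ?_⟩
        intro b hb
        obtain ⟨x, hx, rfl⟩ := List.mem_map.1 hb
        obtain ⟨i, -, rfl⟩ := List.mem_map.1 (hd hx)
        rfl
      simp only [tourWeight_extWeight w o p hdiag hsymm, List.map_append, hrep]
      exact tourWeight_append_replicate w o (hdiag o) _ _)
  rw [hfl] at h2
  have hnd : S'.flatten.Nodup := by
    rw [h2.nodup_iff, List.nodup_append]
    refine ⟨hS.2.1.map Sum.inl_injective, (List.nodup_finRange p).map Sum.inr_injective, ?_⟩
    simp
  have hmem : ∀ v, v ∈ S'.flatten ↔ v ≠ Sum.inl o := by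
    intro v
    rw [h2.mem_iff, List.mem_append]
    rcases v with a | i
    · rw [List.mem_map_of_injective Sum.inl_injective, hS.2.2 a]
      simp
    · simp
  refine ⟨S', ⟨?_, hnd, hmem⟩, h1, ?_⟩
  · intro T hT
    refine ⟨?_, (List.nodup_flatten.1 hnd).1 T hT, (h1 T hT).le, ?_⟩
    · rintro rfl
      have := h1 _ hT
      simp at this
      omega
    · exact fun v hv => (hmem v).1 (List.mem_flatten.2 ⟨T, hT, hv⟩)
  · rw [h3, List.map_map]
    congr 1
    refine List.map_congr_left fun T _ => ?_
    simp [tourWeight_extWeight w o p hdiag hsymm, Function.comp_def]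

/-- If `p ≥ (k-1)(n-1)` new vertices co-located with the depot are added to an instance
`I` of `k`-TC with `n - 1 ≥ 1` non-depot vertices, and `k` divides `(n-1) + p`, then the
extended instance `I′` admits an optimal feasible solution that is saturated (every tour
contains exactly `k` non-depot vertices), and this optimal value equals `OPT(I)`. -/
theorem exists_saturated_optimal {V : Type*} [Fintype V] [DecidableEq V]
    (k : ℕ) (hk : 1 ≤ k) (o : V) (w : V → V → ℝ)
    (hnonneg : ∀ a b, 0 ≤ w a b) (hdiag : ∀ a, w a a = 0)
    (hsymm : ∀ a b, w a b = w b a)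
    (htri : ∀ a b c, w a c ≤ w a b + w b c)
    (n : ℕ) (hn : Fintype.card V = n) (hn1 : 1 ≤ n - 1)
    (p : ℕ) (hp : (k - 1) * (n - 1) ≤ p) (hdiv : k ∣ (n - 1) + p) :
    ∃ S : List (List (V ⊕ Fin p)),
      IsFeasible k (Sum.inl o : V ⊕ Fin p) S ∧
      (∀ T ∈ S, T.length = k) ∧
      (S.map (tourWeight (extWeight w o p) (Sum.inl o))).sum
        = optTC k (Sum.inl o : V ⊕ Fin p) (extWeight w o p) ∧
      optTC k (Sum.inl o : V ⊕ Fin p) (extWeight w o p) = optTC k o w := by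
  subst hn
  obtain ⟨S, hS, hmin⟩ := exists_isFeasible_isLeast hk o w
  obtain ⟨S', hS', hsat, hw⟩ := hS.exists_saturated hk hdiag hsymm hp hdiv
  have hopt := optTC_eq_of_isLeast hS hmin
  have hopt' : optTC k (Sum.inl o : V ⊕ Fin p) (extWeight w o p) = _ :=
    optTC_eq_of_isLeast hS' fun U hU => by
      obtain ⟨U', hU', hle⟩ := hU.exists_restrict hnonneg hdiag hsymm htri
      exact hw.trans_le ((hmin U' hU').trans hle)
  exact ⟨S', hS', hsat, hopt'.symm, by rw [hopt', hw, hopt]⟩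
end

section
/- In the normal super-game schedule between two groups of kd teams, every pair of teams x_a ∈ X and y_b ∈ Y plays exactly two games, one at each venue, and the two days on which they play differ by exactly k modulo 2kd. Consequently, if k ≥ 2 and kd ≥ 2, no pair of teams plays on two consecutive days (where days are taken cyclically modulo 2kd), i.e., the schedule satisfies the no-repeat constraint. -/
/-- In the normal super-game schedule, the day (as an element of `ZMod (2kd)`) on which
team `x_a` (with `a = ki + i′`, i.e. `i = a / k`, `i′ = a % k`) plays its away game
against team `y_b` (with `b = kj + j′`): it is `(2k(i+j) + i′ + j′) mod 2kd`. -/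
def awayDay (k d : ℕ) (a b : Fin (k * d)) : ZMod (2 * k * d) :=
  ((2 * k * (a.1 / k + b.1 / k) + a.1 % k + b.1 % k : ℕ) : ZMod (2 * k * d))

/-- The day on which team `x_a` plays its home game against team `y_b`:
it is `(2k(i+j) + i′ + j′ + k) mod 2kd`. -/
def homeDay (k d : ℕ) (a b : Fin (k * d)) : ZMod (2 * k * d) :=
  ((2 * k * (a.1 / k + b.1 / k) + a.1 % k + b.1 % k + k : ℕ) : ZMod (2 * k * d))

theorem homeDay_eq_awayDay_add (k d : ℕ) (a b : Fin (k * d)) :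
    homeDay k d a b = awayDay k d a b + (k : ZMod (2 * k * d)) := by
  simp only [homeDay, awayDay]
  push_cast
  rfl

theorem ZMod.natCast_ne_zero_of_pos_of_lt {n m : ℕ} (hm : 0 < m) (hmn : m < n) :
    (m : ZMod n) ≠ 0 := by
  rw [Ne, ZMod.natCast_eq_zero_iff]
  exact Nat.not_dvd_of_pos_of_lt hm hmn

/-- Every pair of teams `x_a ∈ X`, `y_b ∈ Y` in the normal super-game schedule plays
exactly two games, one at each venue (the two game days are distinct), and the two days
differ by exactly `k` modulo `2kd`. Consequently, if `k ≥ 2` and `kd ≥ 2`, the two games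
of a pair are never on consecutive days (cyclically modulo `2kd`), i.e. the schedule
satisfies the no-repeat constraint. -/
theorem normal_supergame_no_repeat (k d : ℕ) (hk : 1 ≤ k) (hd : 1 ≤ d)
    (a b : Fin (k * d)) :
    awayDay k d a b ≠ homeDay k d a b ∧
    homeDay k d a b - awayDay k d a b = (k : ZMod (2 * k * d)) ∧
    (2 ≤ k → 2 ≤ k * d →
      homeDay k d a b ≠ awayDay k d a b + 1 ∧
      awayDay k d a b ≠ homeDay k d a b + 1) := by
  have hkd : 2 * k ≤ 2 * k * d := Nat.le_mul_of_pos_right _ hd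
  have hk0 : (k : ZMod (2 * k * d)) ≠ 0 :=
    ZMod.natCast_ne_zero_of_pos_of_lt (by omega) (by omega)
  rw [homeDay_eq_awayDay_add]
  refine ⟨fun h => hk0 (left_eq_add.mp h), add_sub_cancel_left _ _,
    fun hk2 _ => ⟨fun h => ?_, fun h => ?_⟩⟩
  · have h1 : ((k - 1 : ℕ) : ZMod (2 * k * d)) ≠ 0 :=
      ZMod.natCast_ne_zero_of_pos_of_lt (by omega) (by omega)
    apply h1
    rw [Nat.cast_sub hk, Nat.cast_one, add_left_cancel h, sub_self]
  · have h1 : ((k + 1 : ℕ) : ZMod (2 * k * d)) ≠ 0 :=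
      ZMod.natCast_ne_zero_of_pos_of_lt (by omega) (by omega)
    apply h1
    rw [add_assoc] at h
    exact_mod_cast left_eq_add.mp h
end

section
/- In the normal super-game schedule between two groups of kd teams, team x_{ki+i′} plays an away game on day t if and only if (t − (2ki + i′)) mod 2k ∈ {0, …, k−1}, and a home game otherwise; symmetrically, team y_{kj+j′} plays a home game on day t if and only if (t − (2kj + j′)) mod 2k ∈ {0, …, k−1}. Consequently, each team's home/away sequence over the 2kd days, viewed cyclically, consists of alternating blocks of exactly k consecutive away games and exactly k consecutive home games; in particular no team ever has more than k consecutive home games or more than k consecutive away games. -/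
/-- Team `x_a` plays an away game on day `t`. -/
def xPlaysAway (k d : ℕ) (a : Fin (k * d)) (t : ZMod (2 * k * d)) : Prop :=
  ∃ b : Fin (k * d), awayDay k d a b = t

/-- Team `x_a` plays a home game on day `t`. -/
def xPlaysHome (k d : ℕ) (a : Fin (k * d)) (t : ZMod (2 * k * d)) : Prop :=
  ∃ b : Fin (k * d), homeDay k d a b = t

/-- Team `y_b` plays a home game on day `t` (its home games are the away games of the
`x`-teams against it). -/
def yPlaysHome (k d : ℕ) (b : Fin (k * d)) (t : ZMod (2 * k * d)) : Prop :=
  ∃ a : Fin (k * d), awayDay k d a b = t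

/-- Team `y_b` plays an away game on day `t`. -/
def yPlaysAway (k d : ℕ) (b : Fin (k * d)) (t : ZMod (2 * k * d)) : Prop :=
  ∃ a : Fin (k * d), homeDay k d a b = t

/-- The days `2kj + j′ + c` with `kj + j′ < kd` are those whose residue modulo `2k` lies in
`[c, c + k)`, provided `c ≤ k`. -/
theorem exists_slot_eq_iff {k d : ℕ} (hk : 1 ≤ k) (hd : 1 ≤ d) {c : ℕ} (hc : c ≤ k)
    (w : ZMod (2 * k * d)) :
    (∃ b : Fin (k * d), ((2 * k * (b.1 / k) + b.1 % k + c : ℕ) : ZMod (2 * k * d)) = w) ↔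
      c ≤ w.val % (2 * k) ∧ w.val % (2 * k) < c + k := by
  have : NeZero (2 * k * d) := ⟨by positivity⟩
  constructor
  · rintro ⟨b, rfl⟩
    have hb : b.1 % k < k := Nat.mod_lt _ hk
    rw [ZMod.val_natCast, Nat.mod_mul_right_mod, add_assoc, Nat.mul_add_mod,
      Nat.mod_eq_of_lt (by omega)]
    omega
  · rintro ⟨h₁, h₂⟩
    have hq : w.val / (2 * k) < d := Nat.div_lt_of_lt_mul (ZMod.val_lt w)
    have hr : w.val % (2 * k) - c < k := by omega
    refine ⟨⟨k * (w.val / (2 * k)) + (w.val % (2 * k) - c), ?_⟩, ?_⟩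
    · calc k * (w.val / (2 * k)) + (w.val % (2 * k) - c)
          < k * (w.val / (2 * k) + 1) := by rw [mul_add, mul_one]; omega
        _ ≤ k * d := Nat.mul_le_mul_left k hq
    · rw [Nat.mul_add_div hk, Nat.div_eq_of_lt hr, Nat.mul_add_mod, Nat.mod_eq_of_lt hr,
        add_zero, add_assoc, Nat.sub_add_cancel h₁, Nat.div_add_mod, ZMod.natCast_zmod_val]

theorem val_add_half_period_mod_lt_iff {k d : ℕ} (hk : 1 ≤ k) (hd : 1 ≤ d)
    (w : ZMod (2 * k * d)) :
    (w + (k : ZMod (2 * k * d))).val % (2 * k) < k ↔ ¬ w.val % (2 * k) < k := by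
  have : NeZero (2 * k * d) := ⟨by positivity⟩
  have hr : w.val % (2 * k) < 2 * k := Nat.mod_lt _ (by omega)
  rw [ZMod.val_add, Nat.mod_mul_right_mod, ZMod.val_natCast, Nat.add_mod,
    Nat.mod_mul_right_mod, Nat.mod_eq_of_lt (show k < 2 * k by omega)]
  rcases lt_or_ge (w.val % (2 * k)) k with h | h
  · rw [Nat.mod_eq_of_lt (by omega)]
    omega
  · rw [Nat.mod_eq_sub_mod (by omega), Nat.mod_eq_of_lt (by omega)]
    omega

theorem awayDay_comm (k d : ℕ) (a b : Fin (k * d)) : awayDay k d a b = awayDay k d b a := by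
  unfold awayDay
  congr 1
  ring

theorem homeDay_comm (k d : ℕ) (a b : Fin (k * d)) : homeDay k d a b = homeDay k d b a := by
  unfold homeDay
  congr 1
  ring

theorem xPlaysAway_iff {k d : ℕ} (hk : 1 ≤ k) (hd : 1 ≤ d) (a : Fin (k * d))
    (t : ZMod (2 * k * d)) :
    xPlaysAway k d a t ↔
      (t - ((2 * k * (a.1 / k) + a.1 % k : ℕ) : ZMod (2 * k * d))).val % (2 * k) < k := by
  have key := exists_slot_eq_iff hk hd (Nat.zero_le k)
    (t - ((2 * k * (a.1 / k) + a.1 % k : ℕ) : ZMod (2 * k * d)))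
  simp only [Nat.zero_le, true_and, zero_add] at key
  rw [← key]
  refine exists_congr fun b => ?_
  rw [eq_sub_iff_add_eq, awayDay, ← Nat.cast_add]
  ring_nf

theorem xPlaysHome_iff {k d : ℕ} (hk : 1 ≤ k) (hd : 1 ≤ d) (a : Fin (k * d))
    (t : ZMod (2 * k * d)) :
    xPlaysHome k d a t ↔
      ¬ (t - ((2 * k * (a.1 / k) + a.1 % k : ℕ) : ZMod (2 * k * d))).val % (2 * k) < k := by
  have key := exists_slot_eq_iff hk hd le_rfl
    (t - ((2 * k * (a.1 / k) + a.1 % k : ℕ) : ZMod (2 * k * d)))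
  rw [← two_mul, and_iff_left (Nat.mod_lt _ (by omega))] at key
  rw [not_lt, ← key]
  refine exists_congr fun b => ?_
  rw [eq_sub_iff_add_eq, homeDay, ← Nat.cast_add]
  ring_nf

theorem yPlaysHome_iff_xPlaysAway {k d : ℕ} (a : Fin (k * d)) (t : ZMod (2 * k * d)) :
    yPlaysHome k d a t ↔ xPlaysAway k d a t :=
  exists_congr fun b => by rw [awayDay_comm]

theorem yPlaysAway_iff_xPlaysHome {k d : ℕ} (a : Fin (k * d)) (t : ZMod (2 * k * d)) :
    yPlaysAway k d a t ↔ xPlaysHome k d a t :=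
  exists_congr fun b => by rw [homeDay_comm]

theorem xPlaysAway_add_half_period_iff {k d : ℕ} (hk : 1 ≤ k) (hd : 1 ≤ d) (a : Fin (k * d))
    (t : ZMod (2 * k * d)) :
    xPlaysAway k d a (t + (k : ZMod (2 * k * d))) ↔ ¬ xPlaysAway k d a t := by
  rw [xPlaysAway_iff hk hd, xPlaysAway_iff hk hd, add_sub_right_comm,
    val_add_half_period_mod_lt_iff hk hd]

/-- In the normal super-game schedule, team `x_{ki+i′}` plays an away game on day `t`
iff `(t − (2ki + i′)) mod 2k ∈ {0, …, k−1}`, and a home game otherwise; symmetrically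
team `y_{kj+j′}` plays a home game on day `t` iff `(t − (2kj + j′)) mod 2k ∈ {0, …, k−1}`,
and an away game otherwise. Consequently each team's cyclic home/away sequence consists
of alternating blocks of exactly `k` away games and `k` home games; in particular no
team ever has more than `k` consecutive home games or more than `k` consecutive away
games (cyclically). -/
theorem normal_supergame_home_away_pattern (k d : ℕ) (hk : 1 ≤ k) (hd : 1 ≤ d)
    (a : Fin (k * d)) (t : ZMod (2 * k * d)) :
    (xPlaysAway k d a t ↔
      (t - ((2 * k * (a.1 / k) + a.1 % k : ℕ) : ZMod (2 * k * d))).val % (2 * k) < k) ∧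
    (xPlaysHome k d a t ↔
      ¬ (t - ((2 * k * (a.1 / k) + a.1 % k : ℕ) : ZMod (2 * k * d))).val % (2 * k) < k) ∧
    (yPlaysHome k d a t ↔
      (t - ((2 * k * (a.1 / k) + a.1 % k : ℕ) : ZMod (2 * k * d))).val % (2 * k) < k) ∧
    (yPlaysAway k d a t ↔
      ¬ (t - ((2 * k * (a.1 / k) + a.1 % k : ℕ) : ZMod (2 * k * d))).val % (2 * k) < k) ∧
    ¬ (∀ s : Fin (k + 1), xPlaysAway k d a (t + (s.1 : ZMod (2 * k * d)))) ∧
    ¬ (∀ s : Fin (k + 1), xPlaysHome k d a (t + (s.1 : ZMod (2 * k * d)))) ∧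
    ¬ (∀ s : Fin (k + 1), yPlaysAway k d a (t + (s.1 : ZMod (2 * k * d)))) ∧
    ¬ (∀ s : Fin (k + 1), yPlaysHome k d a (t + (s.1 : ZMod (2 * k * d)))) := by
  have hx (u : ZMod (2 * k * d)) : xPlaysHome k d a u ↔ ¬ xPlaysAway k d a u := by
    rw [xPlaysHome_iff hk hd, xPlaysAway_iff hk hd]
  have away : ¬ ∀ s : Fin (k + 1), xPlaysAway k d a (t + (s.1 : ZMod (2 * k * d))) := fun h =>
    (xPlaysAway_add_half_period_iff hk hd a t).1 (h (Fin.last k)) (by simpa using h 0)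
  have home : ¬ ∀ s : Fin (k + 1), xPlaysHome k d a (t + (s.1 : ZMod (2 * k * d))) := fun h =>
    (hx _).1 (h (Fin.last k))
      ((xPlaysAway_add_half_period_iff hk hd a t).2 ((hx t).1 (by simpa using h 0)))
  simp only [yPlaysHome_iff_xPlaysAway, yPlaysAway_iff_xPlaysHome]
  exact ⟨xPlaysAway_iff hk hd a t, xPlaysHome_iff hk hd a t, xPlaysAway_iff hk hd a t,
    xPlaysHome_iff hk hd a t, away, home, home, away⟩
end

section
/- In the left super-game schedule between two groups of kd teams (kd even): (a) on each day every team plays exactly one game, i.e., each day's assignment i′ ↦ (t − i′) mod kd (respectively (t − kd − i′) mod kd) is a perfect matching between X and Y; (b) every pair of teams x_{i′} ∈ X and y_b ∈ Y meets exactly twice, namely on days t₀ = (i′ + b) mod kd and t₀ + kd, once at each venue; (c) the two meetings of any pair are never on consecutive days (they are exactly kd ≥ 2 days apart and do not occupy days 2kd−1 and 0), so the schedule satisfies the no-repeat constraint. -/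
/-- In the left super-game schedule, the opponent (an index in `ZMod (kd)`) of team
`x_a` on day `t ∈ {0, …, 2kd−1}`: it is `y_{(t−a) mod kd}` for `t < kd` and
`y_{(t−kd−a) mod kd}` for `kd ≤ t < 2kd`; since `kd ≡ 0 (mod kd)`, both equal
`(t − a) mod kd`. -/
def leftOpp (kd : ℕ) (a : ZMod kd) (t : ℕ) : ZMod kd :=
  (t : ZMod kd) - a

/-- In the left super-game schedule, whether the game of day `t` is a home game for the
`x`-teams: for `0 ≤ t < kd` the game is at `Y`'s venue if `t` is even and at `X`'s venue
if `t` is odd; for `kd ≤ t < 2kd` the venues are reversed relative to day `t − kd`. -/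
def leftXHome (kd : ℕ) (t : ℕ) : Prop :=
  (t < kd ∧ t % 2 = 1) ∨ (kd ≤ t ∧ t % 2 = 0)

/-- In the left super-game schedule between two groups of `kd` teams (`kd` even):
(a) on each day, the assignment `a ↦ (t − a) mod kd` is a perfect matching between the
two groups (a bijection);
(b) every pair `x_a, y_b` meets exactly twice, on days `t₀ = (a+b) mod kd` and
`t₀ + kd`, once at each venue;
(c) these two meetings are never on consecutive days: they are exactly `kd ≥ 2` days
apart and do not occupy days `2kd − 1` and `0`; hence the no-repeat constraint holds. -/
theorem left_supergame_properties (k d : ℕ) (hk : 1 ≤ k) (hd : 1 ≤ d)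
    (heven : Even (k * d)) :
    (∀ t : ℕ, Function.Bijective (fun a : ZMod (k * d) => leftOpp (k * d) a t)) ∧
    (∀ a b : ZMod (k * d), ∃ t₀ : ℕ, t₀ < k * d ∧ (t₀ : ZMod (k * d)) = a + b ∧
      (∀ t : ℕ, t < 2 * (k * d) → (leftOpp (k * d) a t = b ↔ (t = t₀ ∨ t = t₀ + k * d))) ∧
      Xor' (leftXHome (k * d) t₀) (leftXHome (k * d) (t₀ + k * d)) ∧
      (t₀ + k * d) - t₀ = k * d ∧ 2 ≤ k * d ∧
      ¬ (t₀ = 0 ∧ t₀ + k * d = 2 * (k * d) - 1)) := by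
  have two_le : 2 ≤ k * d := by
    have : 0 < k * d := Nat.mul_pos hk hd
    obtain ⟨m, hm⟩ := heven
    omega
  generalize k * d = n at heven two_le ⊢
  have : NeZero n := ⟨by omega⟩
  have even_mod : n % 2 = 0 := Nat.even_iff.mp heven
  refine ⟨fun t => (Equiv.subLeft (t : ZMod n)).bijective, fun a b => ?_⟩
  have val_lt : (a + b).val < n := ZMod.val_lt (a + b)
  refine ⟨(a + b).val, val_lt, ZMod.natCast_zmod_val _, fun t ht => ?_, ?_, by omega,
    two_le, by omega⟩
  · have opp_iff : leftOpp n a t = b ↔ t % n = (a + b).val := by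
      rw [leftOpp, sub_eq_iff_eq_add', ← ZMod.val_natCast, (ZMod.val_injective n).eq_iff]
    rw [opp_iff]
    rcases lt_or_ge t n with h | h
    · rw [Nat.mod_eq_of_lt h]
      omega
    · rw [Nat.mod_eq_sub_mod h, Nat.mod_eq_of_lt (by omega)]
      omega
  · change Xor _ _
    simp only [xor_def, leftXHome]
    omega
end

section
/- For every even integer m ≥ 6 there exists a double round-robin schedule on m teams over 2(m−1) days that satisfies the no-repeat constraint and the bounded-by-2 constraint, and in which additionally every team plays exactly one home game and one away game during the first two days (so every team's first two days are AH or HA); consequently exactly m/2 teams play away-then-home and exactly m/2 teams play home-then-away on the first two days. -/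
/-- The opponent of team `x ≤ n` in round `r < n` of the circle method on `n + 1` teams (`n` odd):
teams `x, y < n` meet when `x + y ≡ 2 * r` modulo `n`, and team `n` (the hub) meets team `r`. -/
def circleOpp (n r x : ℕ) : ℕ :=
  if x = n then r
  else if x = r then n
  else if 2 * r < x then 2 * r + n - x
  else if 2 * r < x + n then 2 * r - x
  else 2 * r - x - n

/-- A number that is odd exactly when the hub is at home in round `r`; the venue pattern of the
hub is away, home, home, away, home, away, home, … -/
def hubVenue (r : ℕ) : ℕ :=
  if r = 0 then 0 else if r = 1 then 1 else r + 1

/-- A number that is odd exactly when team `x` is at home in round `r` of the circle method. -/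
def circleVenue (n r x : ℕ) : ℕ :=
  if x = n then hubVenue r
  else if x = r then hubVenue r + 1
  else if r ≤ x then x - r
  else x + n - r

/-- The round played on day `t`: the `n` rounds are played twice in the same order. -/
def roundOf (n t : ℕ) : ℕ := if t < n then t else t - n

/-- A number that is odd exactly when team `x` is at home on day `t`; the venues of the second
leg are opposite to those of the first. -/
def dayVenue (n t x : ℕ) : ℕ :=
  if t < n then circleVenue n t x else circleVenue n (t - n) x + 1

theorem roundOf_lt {n t : ℕ} (ht : t < 2 * n) : roundOf n t < n := by
  unfold roundOf; split_ifs <;> omega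

theorem circleOpp_le {n r x : ℕ} (hr : r < n) (hx : x ≤ n) : circleOpp n r x ≤ n := by
  unfold circleOpp; split_ifs <;> omega

theorem circleOpp_ne {n r x : ℕ} (hn : Odd n) (hr : r < n) (hx : x ≤ n) :
    circleOpp n r x ≠ x := by
  obtain ⟨k, rfl⟩ := hn
  unfold circleOpp; split_ifs <;> omega

theorem circleOpp_circleOpp {n r x : ℕ} (hn : Odd n) (hr : r < n) (hx : x ≤ n) :
    circleOpp n r (circleOpp n r x) = x := by
  obtain ⟨k, rfl⟩ := hn
  unfold circleOpp; split_ifs <;> omega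

theorem circleVenue_circleOpp {n r x : ℕ} (hn : Odd n) (hr : r < n) (hx : x ≤ n) :
    (circleVenue n r (circleOpp n r x) + circleVenue n r x) % 2 = 1 := by
  obtain ⟨k, rfl⟩ := hn
  unfold circleVenue circleOpp; split_ifs <;> omega

theorem circleOpp_injective_round {n r s x : ℕ} (hn : Odd n) (hr : r < n) (hs : s < n)
    (hx : x ≤ n) (h : circleOpp n r x = circleOpp n s x) : r = s := by
  obtain ⟨k, rfl⟩ := hn
  unfold circleOpp at h; split_ifs at h <;> omega

theorem exists_circleOpp_eq {n x y : ℕ} (hn : Odd n) (hx : x ≤ n) (hy : y ≤ n) (hxy : x ≠ y) :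
    ∃ r < n, circleOpp n r x = y := by
  obtain ⟨k, rfl⟩ := hn
  have key : ∀ r < 2 * k + 1,
      (x = 2 * k + 1 ∧ r = y ∨ y = 2 * k + 1 ∧ r = x ∨ x < 2 * k + 1 ∧ y < 2 * k + 1 ∧
        (2 * r = x + y ∨ 2 * r = x + y + (2 * k + 1) ∨ 2 * r + (2 * k + 1) = x + y)) →
      circleOpp (2 * k + 1) r x = y := by
    intro r hr h
    unfold circleOpp; split_ifs <;> omega
  by_cases hxn : x = 2 * k + 1
  · exact ⟨y, by omega, key y (by omega) (by omega)⟩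
  by_cases hyn : y = 2 * k + 1
  · exact ⟨x, by omega, key x (by omega) (by omega)⟩
  by_cases heven : (x + y) % 2 = 0
  · exact ⟨(x + y) / 2, by omega, key _ (by omega) (by omega)⟩
  by_cases hlt : x + y < 2 * k + 1
  · exact ⟨(x + y + (2 * k + 1)) / 2, by omega, key _ (by omega) (by omega)⟩
  · exact ⟨(x + y - (2 * k + 1)) / 2, by omega, key _ (by omega) (by omega)⟩

theorem dayVenue_circleOpp {n t x : ℕ} (hn : Odd n) (ht : t < 2 * n) (hx : x ≤ n) :
    (dayVenue n t (circleOpp n (roundOf n t) x) + dayVenue n t x) % 2 = 1 := by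
  have h := circleVenue_circleOpp hn (roundOf_lt ht) hx
  unfold dayVenue
  unfold roundOf at h ⊢
  split_ifs at h ⊢ <;> omega

theorem existsUnique_day {n x y : ℕ} (hn : Odd n) (hx : x ≤ n) (hy : y ≤ n) (hxy : x ≠ y) :
    ∃! t : ℕ, t < 2 * n ∧ circleOpp n (roundOf n t) x = y ∧ dayVenue n t x % 2 = 1 := by
  obtain ⟨r, hr, rfl⟩ := exists_circleOpp_eq hn hx hy hxy
  have huniq : ∀ t < 2 * n, circleOpp n (roundOf n t) x = circleOpp n r x →
      t = r ∨ t = r + n := by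
    intro t ht h
    have := circleOpp_injective_round hn (roundOf_lt ht) hr hx h
    unfold roundOf at this
    split_ifs at this <;> omega
  have hfirst : dayVenue n r x = circleVenue n r x := by simp [dayVenue, hr]
  have hsecond : dayVenue n (r + n) x = circleVenue n r x + 1 := by simp [dayVenue]
  have hround : roundOf n r = r := by simp [roundOf, hr]
  have hround' : roundOf n (r + n) = r := by simp [roundOf]
  by_cases hv : circleVenue n r x % 2 = 1
  · refine ⟨r, ⟨by omega, by rw [hround], by omega⟩, ?_⟩
    rintro t ⟨ht, ho, hh⟩
    rcases huniq t ht ho with rfl | rfl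
    · rfl
    · omega
  · refine ⟨r + n, ⟨by omega, by rw [hround'], by omega⟩, ?_⟩
    rintro t ⟨ht, ho, hh⟩
    rcases huniq t ht ho with rfl | rfl
    · omega
    · rfl

theorem circleOpp_roundOf_succ_ne {n t x : ℕ} (hn : Odd n) (hn2 : 2 ≤ n) (ht : t + 1 < 2 * n)
    (hx : x ≤ n) : circleOpp n (roundOf n t) x ≠ circleOpp n (roundOf n (t + 1)) x := by
  intro h
  have := circleOpp_injective_round hn (roundOf_lt (by omega)) (roundOf_lt ht) hx h
  unfold roundOf at this
  split_ifs at this <;> omega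

theorem dayVenue_zero_ne_one {n x : ℕ} (hn : Odd n) (hn2 : 2 ≤ n) (hx : x ≤ n) :
    dayVenue n 0 x % 2 ≠ dayVenue n 1 x % 2 := by
  obtain ⟨k, rfl⟩ := hn
  intro h
  have h₀ : (0 : ℕ) < 2 * k + 1 := by omega
  have h₁ : 1 < 2 * k + 1 := by omega
  simp only [dayVenue, h₀, h₁, if_true, circleVenue, hubVenue] at h
  split_ifs at h <;> omega

theorem circleVenue_not_three_equal {n r x : ℕ} (hn : Odd n) (hr : r + 2 < n) (hx : x ≤ n) :
    ¬ (circleVenue n r x % 2 = circleVenue n (r + 1) x % 2 ∧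
      circleVenue n (r + 1) x % 2 = circleVenue n (r + 2) x % 2) := by
  obtain ⟨k, rfl⟩ := hn
  rintro ⟨h₁, h₂⟩
  unfold circleVenue at h₁ h₂
  by_cases hxn : x = 2 * k + 1
  · simp only [hxn, if_true] at h₁ h₂
    unfold hubVenue at h₁ h₂
    split_ifs at h₁ h₂ <;> omega
  · simp only [hxn, if_false] at h₁ h₂
    split_ifs at h₁ h₂ <;> omega

theorem dayVenue_not_three_equal {n t x : ℕ} (hn : Odd n) (hn5 : 5 ≤ n) (ht : t + 2 < 2 * n)
    (hx : x ≤ n) :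
    ¬ (dayVenue n t x % 2 = dayVenue n (t + 1) x % 2 ∧
      dayVenue n (t + 1) x % 2 = dayVenue n (t + 2) x % 2) := by
  have hfirst : ∀ s < n, dayVenue n s x = circleVenue n s x := fun s hs => if_pos hs
  have hsecond : ∀ s, dayVenue n (n + s) x = circleVenue n s x + 1 := fun s => by
    simp [dayVenue]
  rintro ⟨h₁, h₂⟩
  by_cases hlt : t + 2 < n
  · rw [hfirst _ (by omega), hfirst _ (by omega)] at h₁
    rw [hfirst _ (by omega), hfirst _ (by omega)] at h₂
    exact circleVenue_not_three_equal hn hlt hx ⟨h₁, h₂⟩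
  by_cases hge : n ≤ t
  · obtain ⟨r, rfl⟩ := Nat.exists_eq_add_of_le hge
    rw [add_assoc, hsecond, hsecond] at h₁
    rw [add_assoc, add_assoc, hsecond, hsecond] at h₂
    exact circleVenue_not_three_equal hn (r := r) (by omega) hx ⟨by omega, by omega⟩
  have hzero := hsecond 0
  have hone := hsecond 1
  have hlast := hfirst (n - 1) (by omega)
  have hpenult := hfirst (n - 2) (by omega)
  obtain ⟨k, rfl⟩ := hn
  have hcases : t = 2 * k + 1 - 2 ∨ t = 2 * k + 1 - 1 := by omega
  simp only [circleVenue, hubVenue] at hzero hone hlast hpenult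
  rcases hcases with rfl | rfl
  · rw [show 2 * k + 1 - 2 + 1 = 2 * k + 1 - 1 by omega] at h₁ h₂
    rw [show 2 * k + 1 - 2 + 2 = 2 * k + 1 + 0 by omega] at h₂
    rw [hpenult, hlast] at h₁
    rw [hlast, hzero] at h₂
    clear hzero hone hlast hpenult hfirst hsecond
    split_ifs at h₁ h₂ <;> omega
  · rw [show 2 * k + 1 - 1 + 1 = 2 * k + 1 + 0 by omega] at h₁ h₂
    rw [show 2 * k + 1 - 1 + 2 = 2 * k + 1 + 1 by omega] at h₂
    rw [hlast, hzero] at h₁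
    rw [hzero, hone] at h₂
    clear hzero hone hlast hpenult hfirst hsecond
    split_ifs at h₁ h₂ <;> omega

/-- If an involution on a fintype flips a Boolean labelling, each label is used equally often. -/
theorem card_filter_eq_half_of_flip {α : Type*} [Fintype α] (f : α → α)
    (c : α → Bool) (hf : Function.Involutive f) (hc : ∀ x, c x ≠ c (f x)) (b : Bool) :
    (Finset.univ.filter fun x => c x = b).card = Fintype.card α / 2 := by
  have hswap : (Finset.univ.filter fun x => c x = b).card =
      (Finset.univ.filter fun x => ¬ c x = b).card := by
    refine Finset.card_nbij' f f ?_ ?_ (fun x _ => hf x) (fun x _ => hf x) <;>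
    · intro x hx
      have hcx := hc x
      rw [Finset.mem_coe, Finset.mem_filter] at hx ⊢
      refine ⟨Finset.mem_univ _, ?_⟩
      revert hx hcx
      cases b <;> cases c x <;> cases c (f x) <;> simp
  have htotal := Finset.card_filter_add_card_filter_not (s := (Finset.univ : Finset α))
    (fun x => c x = b)
  rw [Finset.card_univ] at htotal
  omega


/-- For every even `m ≥ 6` there is a double round-robin schedule on `m` teams over
`2(m−1)` days (given by an opponent function `opp` and a venue function `h`, where
`h t x = true` means team `x` is at home on day `t`) such that: on every day the
opponent function is a fixed-point-free involution and paired teams have opposite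
venues; each ordered pair of distinct teams meets exactly once with the first team at
home (so each pair meets twice, once at each home); the no-repeat constraint holds; the
bounded-by-2 constraint holds; every team plays exactly one home and one away game in
the first two days; and consequently exactly `m/2` teams play away-then-home and exactly
`m/2` teams play home-then-away on the first two days. -/
theorem exists_special_ttp2_schedule (m : ℕ) (hm : Even m) (hm6 : 6 ≤ m) :
    ∃ (opp : ℕ → Fin m → Fin m) (h : ℕ → Fin m → Bool),
      (∀ t < 2 * (m - 1), ∀ x : Fin m,
        opp t x ≠ x ∧ opp t (opp t x) = x ∧ h t x ≠ h t (opp t x)) ∧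
      (∀ x y : Fin m, x ≠ y →
        ∃! t : ℕ, t < 2 * (m - 1) ∧ opp t x = y ∧ h t x = true) ∧
      (∀ x : Fin m, ∀ t : ℕ, t + 1 < 2 * (m - 1) → opp t x ≠ opp (t + 1) x) ∧
      (∀ x : Fin m, ∀ t : ℕ, t + 2 < 2 * (m - 1) →
        ¬ (h t x = h (t + 1) x ∧ h (t + 1) x = h (t + 2) x)) ∧
      (∀ x : Fin m, h 0 x ≠ h 1 x) ∧
      (Finset.univ.filter fun x : Fin m => h 0 x = false).card = m / 2 ∧
      (Finset.univ.filter fun x : Fin m => h 0 x = true).card = m / 2 := by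
  obtain ⟨n, rfl⟩ : ∃ n, m = n + 1 := ⟨m - 1, by omega⟩
  have hn : Odd n := by
    rw [Nat.even_add_one] at hm
    exact Nat.not_even_iff_odd.mp hm
  have hle : ∀ x : Fin (n + 1), (x : ℕ) ≤ n := fun x => Nat.lt_succ_iff.mp x.isLt
  let opp : ℕ → Fin (n + 1) → Fin (n + 1) := fun t x =>
    Fin.ofNat (n + 1) (circleOpp n (roundOf n t) x)
  let h : ℕ → Fin (n + 1) → Bool := fun t x => decide (dayVenue n t x % 2 = 1)
  have hopp : ∀ t < 2 * n, ∀ x, (opp t x : ℕ) = circleOpp n (roundOf n t) x := fun t ht x =>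
    Nat.mod_eq_of_lt (Nat.lt_succ_iff.mpr (circleOpp_le (roundOf_lt ht) (hle x)))
  have hh : ∀ t s x y, h t x = h s y ↔ dayVenue n t x % 2 = dayVenue n s y % 2 := by
    intro t s x y
    simp only [h, decide_eq_decide]
    omega
  have hday : ∀ t < 2 * n, ∀ x,
      opp t x ≠ x ∧ opp t (opp t x) = x ∧ h t x ≠ h t (opp t x) := by
    intro t ht x
    refine ⟨fun he => ?_, ?_, fun he => ?_⟩
    · exact circleOpp_ne hn (roundOf_lt ht) (hle x) (by rw [← hopp t ht, he])
    · apply Fin.ext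
      rw [hopp t ht, hopp t ht, circleOpp_circleOpp hn (roundOf_lt ht) (hle x)]
    · have := dayVenue_circleOpp hn ht (hle x)
      rw [hh, hopp t ht] at he
      omega
  have hhalf := card_filter_eq_half_of_flip (opp 0) (h 0)
    (fun x => (hday 0 (by omega) x).2.1) (fun x => (hday 0 (by omega) x).2.2)
  rw [Fintype.card_fin] at hhalf
  rw [Nat.add_sub_cancel]
  refine ⟨opp, h, hday, ?_, ?_, ?_, ?_, hhalf false, hhalf true⟩
  · intro x y hxy
    refine (existsUnique_congr fun t => and_congr_right fun ht => ?_).mpr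
      (existsUnique_day hn (hle x) (hle y) (Fin.val_ne_of_ne hxy))
    rw [← hopp t ht, Fin.val_inj]
    simp [h]
  · intro x t ht he
    refine circleOpp_roundOf_succ_ne hn (by omega) ht (hle x) ?_
    rw [← hopp t (by omega), ← hopp (t + 1) ht, he]
  · intro x t ht
    rw [hh, hh]
    exact dayVenue_not_three_equal hn (by omega) ht (hle x)
  · intro x
    rw [Ne, hh]
    exact dayVenue_zero_ne_one hn (by omega) (hle x)
end
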